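/- Let A be a complete elevator automaton with n states in which every accepting transition has both endpoints in a single SCC; let Q_W be the union of its accepting inherently weak SCCs, Q_D the union of its accepting deterministic SCCs that are not inherently weak, and Q_N the set of remaining states. Then there exists a Büchi automaton with at most 2 · 2^{|Q_N|} · 3^{|Q_W|} · 4^{|Q_D|} states (in particular, at most 2 · 4^n states) whose language is Σ^ω \ L(A). -/

import Mathlib

attribute [local instance] Classical.propDecidable

universe u v w y

/-- Emerson–Lei acceptance conditions over colours `γ`. -/
inductive EL (γ : Type u) : Type u
  | inf : γ → EL γ
  | fin : γ → EL γ
  | conj : EL γ → EL γ → EL γ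
  | disj : EL γ → EL γ → EL γ

/-- Satisfaction of an Emerson–Lei condition by a set `M` of colours. -/
def EL.sat {γ : Type u} (M : Set γ) : EL γ → Prop
  | .inf c => c ∈ M
  | .fin c => c ∉ M
  | .conj φ ψ => φ.sat M ∧ ψ.sat M
  | .disj φ ψ => φ.sat M ∨ ψ.sat M

/-- Renaming of colours in an Emerson–Lei condition. -/
def EL.map {γ : Type u} {γ' : Type v} (f : γ → γ') : EL γ → EL γ'
  | .inf c => .inf (f c)
  | .fin c => .fin (f c)
  | .conj φ ψ => .conj (φ.map f) (ψ.map f)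
  | .disj φ ψ => .disj (φ.map f) (ψ.map f)

/-- A (transition-based) Büchi automaton over alphabet `A` with states `Q`. -/
structure BA (Q : Type u) (A : Type v) where
  delta : Set (Q × A × Q)
  init : Set Q
  F : Set (Q × A × Q)
  F_sub : F ⊆ delta

namespace BA

variable {Q : Type u} {A : Type v}

/-- `δ(S, a)`. -/
def deltaSet (M : BA Q A) (S : Set Q) (a : A) : Set Q :=
  {q | ∃ p ∈ S, (p, a, q) ∈ M.delta}

/-- `δ_F(S, a)`. -/
def deltaF (M : BA Q A) (S : Set Q) (a : A) : Set Q :=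
  {q | ∃ p ∈ S, (p, a, q) ∈ M.F}

/-- `δ(S, u)` for a finite word `u`. -/
def deltaWord (M : BA Q A) (S : Set Q) : List A → Set Q
  | [] => S
  | a :: u => M.deltaWord (M.deltaSet S a) u

/-- A run of the BA on an infinite word. -/
def IsRun (M : BA Q A) (w : ℕ → A) (ρ : ℕ → Q) : Prop :=
  ρ 0 ∈ M.init ∧ ∀ i, (ρ i, w i, ρ (i + 1)) ∈ M.delta

/-- An accepting run of the BA on an infinite word. -/
def AccRun (M : BA Q A) (w : ℕ → A) (ρ : ℕ → Q) : Prop :=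
  M.IsRun w ρ ∧ {i | (ρ i, w i, ρ (i + 1)) ∈ M.F}.Infinite

/-- The language of the BA. -/
def lang (M : BA Q A) : Set (ℕ → A) := {w | ∃ ρ, M.AccRun w ρ}

/-- Completeness of a BA. -/
def Complete (M : BA Q A) : Prop :=
  M.init.Nonempty ∧ ∀ q a, ∃ q', (q, a, q') ∈ M.delta

/-- One transition step (over some symbol). -/
def Step (M : BA Q A) (p q : Q) : Prop := ∃ a, (p, a, q) ∈ M.delta

/-- Reachability. -/
def Reach (M : BA Q A) : Q → Q → Prop := Relation.ReflTransGen M.Step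

/-- Mutual reachability, i.e., lying in the same SCC. -/
def SameSCC (M : BA Q A) (p q : Q) : Prop := M.Reach p q ∧ M.Reach q p

/-- A strongly connected component: a maximal nonempty set of pairwise
mutually reachable states. -/
def IsSCC (M : BA Q A) (C : Set Q) : Prop :=
  C.Nonempty ∧ (∀ p ∈ C, ∀ q ∈ C, M.Reach p q) ∧
    ∀ D, C ⊆ D → (∀ p ∈ D, ∀ q ∈ D, M.Reach p q) → D ⊆ C

/-- An accepting SCC: one containing an accepting transition with both
endpoints in it. -/
def IsAccSCC (M : BA Q A) (C : Set Q) : Prop :=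
  M.IsSCC C ∧ ∃ p ∈ C, ∃ a, ∃ q ∈ C, (p, a, q) ∈ M.F

/-- `δ_SCC(S, a)`: restriction of `δ` to transitions staying in one SCC. -/
def deltaSCC (M : BA Q A) (S : Set Q) (a : A) : Set Q :=
  {q | ∃ p ∈ S, (p, a, q) ∈ M.delta ∧ M.SameSCC p q}

/-- A cycle of length `k > 0` lying inside the set `C`. -/
def IsCycleIn (M : BA Q A) (C : Set Q) (k : ℕ) (ρ : ℕ → Q) (σ : ℕ → A) : Prop :=
  0 < k ∧ ρ 0 = ρ k ∧ ∀ i < k, ρ i ∈ C ∧ (ρ i, σ i, ρ (i + 1)) ∈ M.delta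

/-- `C` is inherently weak: every cycle inside `C` contains an accepting
transition, or no cycle inside `C` contains one. -/
def InherentlyWeak (M : BA Q A) (C : Set Q) : Prop :=
  (∀ k ρ σ, M.IsCycleIn C k ρ σ → ∃ i < k, (ρ i, σ i, ρ (i + 1)) ∈ M.F) ∨
  (∀ k ρ σ, M.IsCycleIn C k ρ σ → ∀ i < k, (ρ i, σ i, ρ (i + 1)) ∉ M.F)

/-- `C` is a deterministic SCC. -/
def DetSCC (M : BA Q A) (C : Set Q) : Prop :=
  ∀ q ∈ C, ∀ a : A, (M.deltaSet {q} a ∩ C).Subsingleton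

/-- A partition block: a nonempty union of accepting SCCs. -/
def IsPartitionBlock (M : BA Q A) (P : Set Q) : Prop :=
  P.Nonempty ∧ ∃ Cs : Set (Set Q), (∀ C ∈ Cs, M.IsAccSCC C) ∧ P = ⋃₀ Cs

/-- `A_P`: accepting transitions restricted to those between states of `P`. -/
def restrict (M : BA Q A) (P : Set Q) : BA Q A where
  delta := M.delta
  init := M.init
  F := M.F ∩ {t | t.1 ∈ P ∧ t.2.2 ∈ P}
  F_sub := fun _ ht => M.F_sub ht.1

end BA

/-- A partitioning of a BA: pairwise disjoint partition blocks containing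
all accepting SCCs. -/
def IsPartitioning {Q : Type u} {A : Type v} {n : ℕ} (M : BA Q A)
    (P : Fin n → Set Q) : Prop :=
  (∀ i, M.IsPartitionBlock (P i)) ∧
  (Pairwise fun i j => Disjoint (P i) (P j)) ∧
  ∀ C, M.IsAccSCC C → ∃ i, C ⊆ P i

/-- A transition-based Emerson–Lei automaton; transitions carry sets of
colours. -/
structure TELA (Q : Type u) (A : Type v) (γ : Type w) where
  trans : Set (Q × A × Set γ × Q)
  init : Set Q
  acc : EL γ

namespace TELA

variable {Q : Type u} {A : Type v} {γ : Type w}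

/-- A run of the TELA (state sequence together with emitted colour sets). -/
def IsRun (T : TELA Q A γ) (w : ℕ → A) (ρ : ℕ → Q) (κ : ℕ → Set γ) : Prop :=
  ρ 0 ∈ T.init ∧ ∀ i, (ρ i, w i, κ i, ρ (i + 1)) ∈ T.trans

/-- The union of colour sets of transitions occurring infinitely often. -/
def infCols (w : ℕ → A) (ρ : ℕ → Q) (κ : ℕ → Set γ) : Set γ :=
  {c | ∃ t : Q × A × Set γ × Q,
    {i | (ρ i, w i, κ i, ρ (i + 1)) = t}.Infinite ∧ c ∈ t.2.2.1}

/-- An accepting run of the TELA. -/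
def AccRun (T : TELA Q A γ) (w : ℕ → A) (ρ : ℕ → Q) (κ : ℕ → Set γ) : Prop :=
  T.IsRun w ρ κ ∧ EL.sat (infCols w ρ κ) T.acc

/-- The language of the TELA. -/
def lang (T : TELA Q A γ) : Set (ℕ → A) := {w | ∃ ρ κ, T.AccRun w ρ κ}

end TELA

/-- A partial complementation instance for a partition block. -/
structure PartialAlg (Q : Type u) (A : Type v) (T : Type w) (γ : Type y) where
  init : Set T
  succ : Set Q → T → A → Set (T × Set γ)
  acc : EL γ

/-- `ModCompl` for a single partial complementation instance. -/
def ModCompl1 {Q : Type u} {A : Type v} {T : Type w} {γ : Type y}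
    (M : BA Q A) (alg : PartialAlg Q A T γ) : TELA (Set Q × T) A γ where
  init := {x | x.1 = M.init ∧ x.2 ∈ alg.init}
  trans := {x | ∃ H m a m' α, (m', α) ∈ alg.succ H m a ∧
    x = ((H, m), a, α, (M.deltaSet H a, m'))}
  acc := alg.acc

/-- Conjunction of a nonempty family of Emerson–Lei conditions. -/
def ELbigAnd {γ : Type u} {n : ℕ} (f : Fin (n + 1) → EL γ) : EL γ :=
  List.foldl EL.conj (f 0) (List.ofFn fun i : Fin n => f i.succ)

/-- The synchronous modular complementation `ModCompl` for several partial
complementation instances; colours are renumbered via `Sigma.mk`. -/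
def ModComplN {Q : Type u} {A : Type v} {n : ℕ} {T : Fin (n + 1) → Type w}
    {γ : Fin (n + 1) → Type y} (M : BA Q A)
    (alg : ∀ i, PartialAlg Q A (T i) (γ i)) :
    TELA (Set Q × (∀ i, T i)) A (Σ i, γ i) where
  init := {x | x.1 = M.init ∧ ∀ i, x.2 i ∈ (alg i).init}
  trans := {x | ∃ (H : Set Q) (m : ∀ i, T i) (a : A) (m' : ∀ i, T i)
      (α : ∀ i, Set (γ i)),
    (∀ i, (m' i, α i) ∈ (alg i).succ H (m i) a) ∧
    x = ((H, m), a, {c : Σ i, γ i | c.2 ∈ α c.1}, (M.deltaSet H a, m'))}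
  acc := ELbigAnd fun i => ((alg i).acc).map (Sigma.mk i)

/-- A partial round-robin complementation instance. -/
structure RRAlg (Q : Type u) (A : Type v) (Tt Ta : Type w) (γ : Type y) where
  init : Set Tt
  succT : Set Q → Tt → A → Set (Tt × Set γ)
  succA : Set Q → Ta → A → Set ((Tt ⊕ Ta) × Set γ)
  lift : Tt → Set Ta
  acc : EL γ

/-- The flattening `algunion` of a partial round-robin instance. -/
def RRAlg.flatten {Q : Type u} {A : Type v} {Tt Ta : Type w} {γ : Type y}
    (R : RRAlg Q A Tt Ta γ) : PartialAlg Q A (Tt ⊕ Ta) γ where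
  init := Sum.inl '' R.init
  succ := fun H m a =>
    match m with
    | Sum.inr mA => R.succA H mA a
    | Sum.inl mT =>
        {x | ∃ p ∈ R.succT H mT a, x = (Sum.inl p.1, p.2)} ∪
        {x | ∃ p ∈ R.succT H mT a, ∃ m'' ∈ R.lift p.1, x = (Sum.inr m'', p.2)}
  acc := R.acc

/-- Consistency (conditions (C1)–(C3)) of a partial round-robin instance with
respect to a BA `B`. -/
def RRConsistent {Q : Type u} {A : Type v} {Tt Ta : Type w} {γ : Type y}
    (B : BA Q A) (R : RRAlg Q A Tt Ta γ) : Prop :=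
  (∀ w ∈ (ModCompl1 B R.flatten).lang, ∃ ρ κ,
      (ModCompl1 B R.flatten).AccRun w ρ κ ∧
      {j | (ρ j).2.isRight = true ∧ ¬ (ρ (j + 1)).2.isRight = true}.Infinite) ∧
  (∀ w ρ κ, (ModCompl1 B R.flatten).AccRun w ρ κ → ∀ i : ℕ,
      (i = 0 ∨ (ρ (i - 1)).2.isLeft = true) →
      ((∃ ρ' κ', (ModCompl1 B R.flatten).AccRun w ρ' κ' ∧
          (∀ j < i, ρ' j = ρ j) ∧ (ρ' i).2.isLeft = true) ∧
       (∃ ρ'' κ'', (ModCompl1 B R.flatten).AccRun w ρ'' κ'' ∧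
          (∀ j < i, ρ'' j = ρ j) ∧ (ρ'' i).2.isRight = true))) ∧
  (∀ w ρ κ, (ModCompl1 B R.flatten).IsRun w ρ κ →
      {j | (ρ j).2.isRight = true ∧ ¬ (ρ (j + 1)).2.isRight = true}.Infinite →
      (ModCompl1 B R.flatten).AccRun w ρ κ)

/-- The union of the accepting inherently weak SCCs. -/
def BA.weakPart {Q A : Type} (M : BA Q A) : Set Q :=
  {q | ∃ C, M.IsAccSCC C ∧ M.InherentlyWeak C ∧ q ∈ C}

/-- The union of the accepting deterministic SCCs that are not inherently
weak. -/
def BA.detPart {Q A : Type} (M : BA Q A) : Set Q :=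
  {q | ∃ C, M.IsAccSCC C ∧ M.DetSCC C ∧ ¬ M.InherentlyWeak C ∧ q ∈ C}

/-- The accepting transitions with both endpoints in `detPart`. -/
def BA.FD {Q A : Type} (M : BA Q A) : Set (Q × A × Q) :=
  {t | t ∈ M.F ∧ t.1 ∈ M.detPart ∧ t.2.2 ∈ M.detPart}

/-- `δ_{F_D}(S, a)`. -/
def BA.deltaFD {Q A : Type} (M : BA Q A) (S : Set Q) (a : A) : Set Q :=
  {q | ∃ p ∈ S, (p, a, q) ∈ M.FD}

/-- Kőnig's lemma for layered graphs with finitely many vertices per layer. -/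
theorem exists_path_of_layers {Q : Type} [Finite Q] (X : ℕ → Set Q) (R : ℕ → Q → Q → Prop)
    (hne : ∀ i, (X i).Nonempty) (hpred : ∀ i, ∀ q ∈ X (i + 1), ∃ p ∈ X i, R i p q) :
    ∃ ρ : ℕ → Q, ∀ i, ρ i ∈ X i ∧ R i (ρ i) (ρ (i + 1)) := by
  have hfin : ∀ k, ∀ q ∈ X k, ∃ p : ℕ → Q, p k = q ∧ (∀ i ≤ k, p i ∈ X i) ∧
      ∀ i < k, R i (p i) (p (i + 1)) := by
    intro k
    induction k with
    | zero => exact fun q hq => ⟨fun _ => q, rfl, by simpa using hq, by simp⟩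
    | succ k ih =>
      intro q hq
      obtain ⟨r, hr, hrq⟩ := hpred k q hq
      obtain ⟨p, hpk, hpX, hpR⟩ := ih r hr
      refine ⟨Function.update p (k + 1) q, by simp, fun i hi => ?_, fun i hi => ?_⟩
      · rcases Nat.lt_or_eq_of_le hi with h | rfl
        · rw [Function.update_of_ne (by omega)]
          exact hpX i (by omega)
        · simpa using hq
      · rw [Function.update_of_ne (by omega : i ≠ k + 1)]
        rcases Nat.lt_or_eq_of_le (Nat.lt_succ_iff.mp hi) with h | rfl
        · rw [Function.update_of_ne (by omega)]
          exact hpR i h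
        · simpa [hpk] using hrq
  have hpath : ∀ k, ∃ p : ℕ → Q, (∀ i ≤ k, p i ∈ X i) ∧ ∀ i < k, R i (p i) (p (i + 1)) := by
    intro k
    obtain ⟨q, hq⟩ := hne k
    obtain ⟨p, -, h⟩ := hfin k q hq
    exact ⟨p, h⟩
  choose p hpX hpR using hpath
  have hlim : ∀ i, ∃ q, ∀ᶠ k in (Filter.hyperfilter ℕ : Filter ℕ), p k i = q := by
    intro i
    obtain ⟨q, hq⟩ := ((Filter.hyperfilter ℕ).map fun k => p k i).eq_pure_of_finite
    refine ⟨q, ?_⟩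
    have : {q} ∈ (Filter.hyperfilter ℕ).map fun k => p k i := by rw [hq]; exact rfl
    exact this
  choose ρ hρ using hlim
  refine ⟨ρ, fun i => ?_⟩
  have hlarge : ∀ᶠ k in (Filter.hyperfilter ℕ : Filter ℕ), i < k :=
    Nat.hyperfilter_le_atTop (Filter.eventually_gt_atTop i)
  obtain ⟨k, ⟨hk, hk'⟩, hik⟩ := (((hρ i).and (hρ (i + 1))).and hlarge).exists
  exact ⟨hk ▸ hpX k i hik.le, hk ▸ hk' ▸ hpR k i hik⟩

namespace BA

section

variable {Q A : Type} (M : BA Q A)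

theorem SameSCC.symm {M : BA Q A} {p q : Q} (h : M.SameSCC p q) : M.SameSCC q p := ⟨h.2, h.1⟩

theorem SameSCC.trans {M : BA Q A} {p q r : Q} (h : M.SameSCC p q) (h' : M.SameSCC q r) :
    M.SameSCC p r :=
  ⟨Relation.ReflTransGen.trans h.1 h'.1, Relation.ReflTransGen.trans h'.2 h.2⟩

theorem SameSCC.refl (q : Q) : M.SameSCC q q :=
  ⟨Relation.ReflTransGen.refl, Relation.ReflTransGen.refl⟩

theorem isSCC_setOf_sameSCC (q : Q) : M.IsSCC {p | M.SameSCC q p} :=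
  ⟨⟨q, SameSCC.refl M q⟩, fun _ hp _ hr => (hp.symm.trans hr).1, fun _ hD hDr _ hr =>
    ⟨hDr _ (hD (SameSCC.refl M q)) _ hr, hDr _ hr _ (hD (SameSCC.refl M q))⟩⟩

variable {M}

theorem IsSCC.mem_of_sameSCC {C : Set Q} (hC : M.IsSCC C) {p q : Q} (hp : p ∈ C)
    (h : M.SameSCC p q) : q ∈ C :=
  hC.2.2 {r | M.SameSCC p r} (fun _ hr => ⟨hC.2.1 _ hp _ hr, hC.2.1 _ hr _ hp⟩)
    (isSCC_setOf_sameSCC M p).2.1 h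

theorem weakPart_of_sameSCC {p q : Q} (hp : p ∈ M.weakPart) (h : M.SameSCC p q) :
    q ∈ M.weakPart := by
  obtain ⟨C, hC, hw, hpC⟩ := hp
  exact ⟨C, hC, hw, hC.1.mem_of_sameSCC hpC h⟩

theorem detPart_of_sameSCC {p q : Q} (hp : p ∈ M.detPart) (h : M.SameSCC p q) :
    q ∈ M.detPart := by
  obtain ⟨C, hC, hd, hw, hpC⟩ := hp
  exact ⟨C, hC, hd, hw, hC.1.mem_of_sameSCC hpC h⟩

theorem mem_weakPart_union_detPart
    (helev : ∀ C, M.IsAccSCC C → M.InherentlyWeak C ∨ M.DetSCC C) {p q : Q} {a : A}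
    (hF : (p, a, q) ∈ M.F) (h : M.SameSCC p q) : p ∈ M.weakPart ∪ M.detPart := by
  have hacc : M.IsAccSCC {r | M.SameSCC p r} :=
    ⟨isSCC_setOf_sameSCC M p, p, SameSCC.refl M p, a, q, h, hF⟩
  by_cases hw : M.InherentlyWeak {r | M.SameSCC p r}
  · exact Or.inl ⟨_, hacc, hw, SameSCC.refl M p⟩
  · exact Or.inr ⟨_, hacc, (helev _ hacc).resolve_left hw, hw, SameSCC.refl M p⟩

theorem detPart_deterministic {p q q' : Q} {a : A} (hp : p ∈ M.detPart)
    (hq : (p, a, q) ∈ M.delta) (hpq : M.SameSCC p q)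
    (hq' : (p, a, q') ∈ M.delta) (hpq' : M.SameSCC p q') : q = q' := by
  obtain ⟨C, hC, hd, -, hpC⟩ := hp
  exact hd p hpC a ⟨⟨p, rfl, hq⟩, hC.1.mem_of_sameSCC hpC hpq⟩
    ⟨⟨p, rfl, hq'⟩, hC.1.mem_of_sameSCC hpC hpq'⟩

theorem exists_walk_of_reach [Nonempty A] {p q : Q} (h : M.Reach p q) :
    ∃ (k : ℕ) (ρ : ℕ → Q) (σ : ℕ → A), ρ 0 = p ∧ ρ k = q ∧
      (∀ i < k, (ρ i, σ i, ρ (i + 1)) ∈ M.delta) ∧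
      ∀ i ≤ k, M.Reach p (ρ i) ∧ M.Reach (ρ i) q := by
  induction h using Relation.ReflTransGen.head_induction_on with
  | refl =>
    exact ⟨0, fun _ => q, fun _ => Classical.arbitrary A, rfl, rfl, by simp,
      fun _ _ => ⟨Relation.ReflTransGen.refl, Relation.ReflTransGen.refl⟩⟩
  | @head p r hpr hrq ih =>
    obtain ⟨k, ρ, σ, h0, hk, hstep, hmid⟩ := ih
    obtain ⟨a, ha⟩ := hpr
    refine ⟨k + 1, fun i => Nat.casesOn i p ρ, fun i => Nat.casesOn i a σ, rfl, hk,
      fun i hi => ?_, fun i hi => ?_⟩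
    · cases i with
      | zero => simpa [h0] using ha
      | succ i => exact hstep i (by omega)
    · cases i with
      | zero => exact ⟨Relation.ReflTransGen.refl, Relation.ReflTransGen.head ⟨a, ha⟩ hrq⟩
      | succ i =>
        exact ⟨Relation.ReflTransGen.head ⟨a, ha⟩ (hmid i (by omega)).1, (hmid i (by omega)).2⟩

theorem InherentlyWeak.exists_mem_F_of_isCycleIn [Nonempty A] {C : Set Q} (hC : M.IsAccSCC C)
    (hw : M.InherentlyWeak C) {k : ℕ} {ρ : ℕ → Q} {σ : ℕ → A} (hcyc : M.IsCycleIn C k ρ σ) :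
    ∃ i < k, (ρ i, σ i, ρ (i + 1)) ∈ M.F := by
  rcases hw with hw | hw
  · exact hw k ρ σ hcyc
  · exfalso
    obtain ⟨hC, p, hp, a, q, hq, hF⟩ := hC
    obtain ⟨l, τ, θ, h0, hl, hstep, hmid⟩ := exists_walk_of_reach (hC.2.1 q hq p hp)
    refine hw (l + 1) (fun i => Nat.casesOn i p τ) (fun i => Nat.casesOn i a θ)
      ⟨by omega, hl.symm, fun i hi => ?_⟩ 0 (by omega) (by simpa [h0] using hF)
    cases i with
    | zero => exact ⟨hp, by simpa [h0] using M.F_sub hF⟩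
    | succ i =>
      refine ⟨hC.mem_of_sameSCC hq ⟨(hmid i (by omega)).1, ?_⟩, hstep i (by omega)⟩
      exact (hmid i (by omega)).2.trans (hC.2.1 p hp q hq)

theorem sameSCC_of_steps {ρ : ℕ → Q} {n : ℕ} (hscc : ∀ i ≥ n, M.SameSCC (ρ i) (ρ (i + 1)))
    {i j : ℕ} (hi : n ≤ i) (hij : i ≤ j) : M.SameSCC (ρ i) (ρ j) := by
  induction j, hij using Nat.le_induction with
  | base => exact SameSCC.refl M _
  | succ j hj ih => exact ih.trans (hscc j (by omega))

theorem exists_mem_F_of_weakPart [Nonempty A] [Finite Q] {w : ℕ → A} {ρ : ℕ → Q}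
    (hδ : ∀ i, (ρ i, w i, ρ (i + 1)) ∈ M.delta) {n : ℕ}
    (hscc : ∀ i ≥ n, M.SameSCC (ρ i) (ρ (i + 1))) (hn : ρ n ∈ M.weakPart) :
    ∃ i ≥ n, (ρ i, w i, ρ (i + 1)) ∈ M.F := by
  obtain ⟨C, hC, hw, hnC⟩ := hn
  obtain ⟨i, j, hij, heq⟩ := Finite.exists_ne_map_eq_of_infinite fun i => ρ (n + i)
  wlog hlt : i < j generalizing i j
  · exact this j i hij.symm heq.symm (by omega)
  obtain ⟨k, -, hk⟩ := hw.exists_mem_F_of_isCycleIn hC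
    (k := j - i) (ρ := fun l => ρ (n + i + l)) (σ := fun l => w (n + i + l))
    ⟨by omega, by simpa [show n + i + (j - i) = n + j by omega] using heq, fun l _ =>
      ⟨hC.1.mem_of_sameSCC hnC (sameSCC_of_steps hscc le_rfl (by omega)), hδ _⟩⟩
  exact ⟨n + i + k, by omega, hk⟩

theorem IsRun.exists_sameSCC [Finite Q] {w : ℕ → A} {ρ : ℕ → Q} (h : M.IsRun w ρ) :
    ∃ n, ∀ i ≥ n, M.SameSCC (ρ i) (ρ (i + 1)) := by
  have hreach : ∀ i j, i ≤ j → M.Reach (ρ i) (ρ j) := by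
    intro i j hij
    induction j, hij using Nat.le_induction with
    | base => exact Relation.ReflTransGen.refl
    | succ j _ ih => exact Relation.ReflTransGen.tail ih ⟨w j, h.2 j⟩
  obtain ⟨q, hq⟩ := Finite.exists_infinite_fiber ρ
  have hinf : (ρ ⁻¹' {q}).Infinite := Set.infinite_coe_iff.mp hq
  obtain ⟨n, hn⟩ := hinf.nonempty
  refine ⟨n, fun i hi => ⟨hreach _ _ (by omega), ?_⟩⟩
  obtain ⟨m, hm, hmi⟩ := hinf.exists_gt (i + 1)
  have hnm : ρ m = ρ n := hm.trans hn.symm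
  exact (hreach (i + 1) m hmi.le).trans (hnm ▸ hreach n i hi)

variable (M)

/-- The states reachable after reading the first `i` letters of `w`. -/
def level (w : ℕ → A) : ℕ → Set Q
  | 0 => M.init
  | i + 1 => M.deltaSet (level w i) (w i)

/-- A family of states, indexed by positions in `w`, closed under transitions inside an SCC and
never taking an accepting one. -/
def IsSafeFamily (w : ℕ → A) (S : ℕ → Set Q) : Prop :=
  ∀ i, ∀ p ∈ S i, ∀ q, (p, w i, q) ∈ M.delta → M.SameSCC p q → (p, w i, q) ∉ M.F ∧ q ∈ S (i + 1)

/-- The states of `detPart` from which no accepting transition can be taken on the suffix of `w`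
from position `i` without leaving the SCC. -/
def safe (w : ℕ → A) (i : ℕ) : Set Q :=
  {q | q ∈ M.detPart ∧ ∃ S, M.IsSafeFamily w S ∧ q ∈ S i}

/-- The breakpoint sets along `w`, reset, whenever they run empty, to all states outside `safe`. -/
def breakpoint (w : ℕ → A) : ℕ → Set Q
  | 0 => ∅
  | i + 1 => {q | q ∈ M.level w (i + 1) ∧ q ∈ M.weakPart ∪ M.detPart ∧ q ∉ M.safe w (i + 1) ∧
      (breakpoint w i = ∅ ∨ q ∈ M.deltaSCC (breakpoint w i) (w i))}

variable {M}

theorem breakpoint_subset (w : ℕ → A) (i : ℕ) {q : Q} (hq : q ∈ M.breakpoint w i) :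
    q ∈ M.level w i ∧ q ∈ M.weakPart ∪ M.detPart ∧ q ∉ M.safe w i := by
  cases i with
  | zero => exact hq.elim
  | succ i => exact ⟨hq.1, hq.2.1, hq.2.2.1⟩

theorem isSafeFamily_safe (w : ℕ → A) : M.IsSafeFamily w (M.safe w) := by
  rintro i p ⟨hd, S, hS, hp⟩ q hδ hscc
  obtain ⟨hF, hq⟩ := hS i p hp q hδ hscc
  exact ⟨hF, detPart_of_sameSCC hd hscc, S, hS, hq⟩

theorem mem_safe_of_run {w : ℕ → A} {ρ : ℕ → Q} (hδ : ∀ i, (ρ i, w i, ρ (i + 1)) ∈ M.delta)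
    {n : ℕ} (hscc : ∀ i ≥ n, M.SameSCC (ρ i) (ρ (i + 1))) (hn : ρ n ∈ M.detPart)
    (hF : ∀ i ≥ n, (ρ i, w i, ρ (i + 1)) ∉ M.F) : ρ n ∈ M.safe w n := by
  refine ⟨hn, fun i => {q | n ≤ i ∧ q = ρ i}, ?_, le_rfl, rfl⟩
  rintro i p ⟨hi, rfl⟩ q hq hpq
  have hd : ρ i ∈ M.detPart := detPart_of_sameSCC hn (sameSCC_of_steps hscc le_rfl hi)
  obtain rfl := detPart_deterministic hd (hδ i) (hscc i hi) hq hpq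
  exact ⟨hF i hi, by omega, rfl⟩

theorem level_nonempty (hcompl : M.Complete) (w : ℕ → A) (i : ℕ) : (M.level w i).Nonempty := by
  induction i with
  | zero => exact hcompl.1
  | succ i ih =>
    obtain ⟨p, hp⟩ := ih
    obtain ⟨q, hq⟩ := hcompl.2 p (w i)
    exact ⟨q, p, hp, hq⟩

theorem frequently_breakpoint_eq_empty [Nonempty A] [Finite Q] (hcompl : M.Complete)
    {w : ℕ → A} (hw : w ∉ M.lang) (n : ℕ) : ∃ i ≥ n, M.breakpoint w i = ∅ := by
  by_contra! hne
  obtain ⟨ρ, hρ⟩ := exists_path_of_layers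
    (fun i => {q | q ∈ M.level w i ∧ (n ≤ i → q ∈ M.breakpoint w i)})
    (fun i p q => (p, w i, q) ∈ M.delta ∧ (n ≤ i → M.SameSCC p q))
    (fun i => by
      by_cases hi : n ≤ i
      · obtain ⟨q, hq⟩ := hne i hi
        exact ⟨q, (breakpoint_subset w i hq).1, fun _ => hq⟩
      · obtain ⟨q, hq⟩ := level_nonempty hcompl w i
        exact ⟨q, hq, fun h => absurd h hi⟩)
    (fun i q hq => by
      by_cases hi : n ≤ i
      · obtain ⟨-, -, -, hemp | ⟨p, hp, hδ, hscc⟩⟩ := hq.2 (by omega)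
        · exact absurd hemp (hne i hi).ne_empty
        · exact ⟨p, ⟨(breakpoint_subset w i hp).1, fun _ => hp⟩, hδ, fun _ => hscc⟩
      · obtain ⟨p, hp, hδ⟩ := hq.1
        exact ⟨p, ⟨hp, fun h => absurd h hi⟩, hδ, fun h => absurd h hi⟩)
  have hδ : ∀ i, (ρ i, w i, ρ (i + 1)) ∈ M.delta := fun i => (hρ i).2.1
  have hscc : ∀ i ≥ n, M.SameSCC (ρ i) (ρ (i + 1)) := fun i hi => (hρ i).2.2 hi
  refine hw ⟨ρ, ⟨(hρ 0).1.1, hδ⟩, ?_⟩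
  refine Set.infinite_of_forall_exists_gt fun m => ?_
  have hmem := breakpoint_subset w _ ((hρ (n + m + 1)).1.2 (by omega))
  have hscc' : ∀ i ≥ n + m + 1, M.SameSCC (ρ i) (ρ (i + 1)) := fun i hi => hscc i (by omega)
  have key : ∃ i ≥ n + m + 1, (ρ i, w i, ρ (i + 1)) ∈ M.F := by
    rcases hmem.2.1 with hW | hD
    · exact exists_mem_F_of_weakPart hδ hscc' hW
    · by_contra! hnF
      exact hmem.2.2 (mem_safe_of_run hδ hscc' hD hnF)
  obtain ⟨i, hi, hF⟩ := key
  exact ⟨i, hF, by omega⟩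

variable (M)

/-- The number of labels a state may carry in the complement automaton: `0` for unreached, `1` for
reached, `2` for reached and in the breakpoint set, and `3` for reached and guessed safe. -/
noncomputable def numLabels (q : Q) : ℕ :=
  if q ∈ M.detPart then 4 else if q ∈ M.weakPart then 3 else 2

/-- The transitions of the complement automaton. -/
def complementDelta : Set ((∀ q, Fin (M.numLabels q)) × A × ∀ q, Fin (M.numLabels q)) :=
  {t |
    (∀ p q, (t.1 p).val ≠ 0 → (p, t.2.1, q) ∈ M.delta → (t.2.2 q).val ≠ 0) ∧
    (∀ p q, (t.1 p).val = 3 → (p, t.2.1, q) ∈ M.delta → M.SameSCC p q →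
      (p, t.2.1, q) ∉ M.F ∧ (t.2.2 q).val = 3) ∧
    (∀ p q, (t.1 p).val = 2 → (p, t.2.1, q) ∈ M.delta → M.SameSCC p q →
      (t.2.2 q).val = 2 ∨ (t.2.2 q).val = 3) ∧
    ((∀ q, (t.1 q).val ≠ 2) → ∀ q ∈ M.weakPart ∪ M.detPart, (t.2.2 q).val ≠ 1)}

/-- The complement of an elevator automaton, with subset states labelled as in `numLabels`; a
transition is accepting when the breakpoint set of its source is empty. -/
def complement : BA (∀ q, Fin (M.numLabels q)) A where
  delta := M.complementDelta
  init := {f | ∀ q ∈ M.init, (f q).val ≠ 0}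
  F := {t | (∀ q, (t.1 q).val ≠ 2) ∧ t ∈ M.complementDelta}
  F_sub := fun _ ht => ht.2

variable {M}

theorem complement_lang_subset [Finite Q]
    (helev : ∀ C, M.IsAccSCC C → M.InherentlyWeak C ∨ M.DetSCC C) :
    M.complement.lang ⊆ M.langᶜ := by
  rintro w ⟨f, ⟨hf0, hf⟩, hfF⟩ ⟨ρ, hrun, hinf⟩
  obtain ⟨n, hscc⟩ := hrun.exists_sameSCC
  have hδ := hrun.2
  have hne : ∀ i, (f i (ρ i)).val ≠ 0 := by
    intro i
    induction i with
    | zero => exact hf0 _ hrun.1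
    | succ i ih => exact (hf i).1 _ _ ih (hδ i)
  have hWD : ∀ i ≥ n, ρ i ∈ M.weakPart ∪ M.detPart := by
    intro i hi
    obtain ⟨j, hj, hij⟩ := hinf.exists_gt i
    have h := mem_weakPart_union_detPart helev hj (hscc j (by omega))
    have hs := (sameSCC_of_steps hscc hi hij.le).symm
    exact h.imp (weakPart_of_sameSCC · hs) (detPart_of_sameSCC · hs)
  have hne3 : ∀ i ≥ n, (f i (ρ i)).val ≠ 3 := by
    intro i hi h3
    have hstay : ∀ j ≥ i, (f j (ρ j)).val = 3 := by
      intro j hj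
      induction j, hj using Nat.le_induction with
      | base => exact h3
      | succ j hj ih => exact ((hf j).2.1 _ _ ih (hδ j) (hscc j (by omega))).2
    obtain ⟨j, hj, hij⟩ := hinf.exists_gt i
    exact ((hf j).2.1 _ _ (hstay j hij.le) (hδ j) (hscc j (by omega))).1 hj
  obtain ⟨m, hm, hnm⟩ := hfF.exists_gt n
  have hstart : (f (m + 1) (ρ (m + 1))).val = 2 := by
    have h1 := (hf m).2.2.2 hm.1 _ (hWD (m + 1) (by omega))
    have h3 := hne3 (m + 1) (by omega)
    have h0 := hne (m + 1)
    have hlt : (f (m + 1) (ρ (m + 1))).val < 4 := by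
      refine lt_of_lt_of_le (f (m + 1) (ρ (m + 1))).isLt ?_
      unfold numLabels
      split_ifs <;> omega
    dsimp only at h1
    omega
  have hstay : ∀ j ≥ m + 1, (f j (ρ j)).val = 2 := by
    intro j hj
    induction j, hj using Nat.le_induction with
    | base => exact hstart
    | succ j hj ih =>
      exact ((hf j).2.2.1 _ _ ih (hδ j) (hscc j (by omega))).resolve_right
        (hne3 (j + 1) (by omega))
  obtain ⟨k, hk, hmk⟩ := hfF.exists_gt (m + 1)
  exact hk.1 _ (hstay k hmk.le)

variable (M) in
/-- The labels guessed by the complement automaton on a word outside the language. -/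
noncomputable def labelNat (w : ℕ → A) (i : ℕ) (q : Q) : ℕ :=
  if q ∉ M.level w i then 0 else if q ∈ M.safe w i then 3 else
    if q ∈ M.breakpoint w i then 2 else 1

theorem labelNat_lt (w : ℕ → A) (i : ℕ) (q : Q) : M.labelNat w i q < M.numLabels q := by
  have hsafe : q ∈ M.safe w i → q ∈ M.detPart := fun h => h.1
  have hbreak : q ∈ M.breakpoint w i → q ∈ M.weakPart ∪ M.detPart :=
    fun h => (breakpoint_subset w i h).2.1
  simp only [Set.mem_union] at hbreak
  unfold labelNat numLabels
  split_ifs <;> first | omega | tauto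

theorem subset_complement_lang [Nonempty A] [Finite Q] (hcompl : M.Complete) :
    M.langᶜ ⊆ M.complement.lang := by
  intro w hw
  let f : ℕ → ∀ q, Fin (M.numLabels q) := fun i q => ⟨M.labelNat w i q, labelNat_lt w i q⟩
  have hfval : ∀ i q, (f i q).val = M.labelNat w i q := fun _ _ => rfl
  have h0 : ∀ i q, M.labelNat w i q ≠ 0 ↔ q ∈ M.level w i := by
    intro i q
    unfold labelNat
    split_ifs <;> simp_all
  have h1 : ∀ i q, M.labelNat w i q = 1 ↔
      q ∈ M.level w i ∧ q ∉ M.safe w i ∧ q ∉ M.breakpoint w i := by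
    intro i q
    unfold labelNat
    split_ifs <;> simp_all
  have h2 : ∀ i q, M.labelNat w i q = 2 ↔ q ∈ M.breakpoint w i := by
    intro i q
    have := fun h : q ∈ M.breakpoint w i => breakpoint_subset w i h
    unfold labelNat
    split_ifs <;> simp_all
  have h3 : ∀ i q, M.labelNat w i q = 3 ↔ q ∈ M.level w i ∧ q ∈ M.safe w i := by
    intro i q
    unfold labelNat
    split_ifs <;> simp_all
  have hstep : ∀ i, (f i, w i, f (i + 1)) ∈ M.complement.delta := by
    intro i
    refine ⟨fun p q hp hδ => ?_, fun p q hp hδ hscc => ?_, fun p q hp hδ hscc => ?_,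
      fun hemp q hq => ?_⟩
    · rw [hfval, h0] at *
      exact ⟨p, hp, hδ⟩
    · rw [hfval, h3] at *
      obtain ⟨hF, hs⟩ := isSafeFamily_safe w i p hp.2 q hδ hscc
      exact ⟨hF, ⟨p, hp.1, hδ⟩, hs⟩
    · rw [hfval, h2] at hp
      obtain ⟨hl, hWD, -⟩ := breakpoint_subset w i hp
      have hq : q ∈ M.level w (i + 1) := ⟨p, hl, hδ⟩
      rw [hfval, h2, h3]
      by_cases hs : q ∈ M.safe w (i + 1)
      · exact Or.inr ⟨hq, hs⟩
      · exact Or.inl ⟨hq, hWD.imp (weakPart_of_sameSCC · hscc) (detPart_of_sameSCC · hscc), hs,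
          Or.inr ⟨p, hp, hδ, hscc⟩⟩
    · have hB : M.breakpoint w i = ∅ :=
        Set.eq_empty_of_forall_notMem fun q hq => hemp q ((h2 i q).mpr hq)
      rw [hfval, Ne, h1]
      rintro ⟨hl, hs, hb⟩
      exact hb ⟨hl, hq, hs, Or.inl hB⟩
  refine ⟨f, ⟨fun q hq => (h0 0 q).mpr hq, hstep⟩, Set.infinite_of_forall_exists_gt fun n => ?_⟩
  obtain ⟨i, hi, hB⟩ := frequently_breakpoint_eq_empty hcompl hw (n + 1)
  refine ⟨i, ⟨fun q hq => ?_, hstep i⟩, by omega⟩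
  have := (h2 i q).mp hq
  simp [hB] at this

theorem prod_ite_mem_const [Fintype Q] (S : Set Q) (c : ℕ) :
    ∏ q, (if q ∈ S then c else 1) = c ^ S.ncard := by
  rw [Set.ncard_eq_toFinset_card', Finset.prod_ite]
  simp [Set.toFinset]

theorem prod_numLabels_le [Fintype Q] :
    ∏ q, M.numLabels q ≤ 2 ^ ((M.weakPart ∪ M.detPart)ᶜ.ncard) * 3 ^ (M.weakPart.ncard) *
      4 ^ (M.detPart.ncard) := by
  rw [← prod_ite_mem_const, ← prod_ite_mem_const, ← prod_ite_mem_const,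
    ← Finset.prod_mul_distrib, ← Finset.prod_mul_distrib]
  refine Finset.prod_le_prod' fun q _ => ?_
  unfold numLabels
  by_cases hD : q ∈ M.detPart <;> by_cases hW : q ∈ M.weakPart <;> simp [hD, hW]

theorem prod_numLabels_le_four_pow [Fintype Q] : ∏ q, M.numLabels q ≤ 4 ^ Fintype.card Q := by
  refine (Finset.prod_le_pow_card _ _ 4 fun q _ => ?_).trans_eq (by simp)
  unfold numLabels
  split_ifs <;> omega

/-- Renaming the states of an automaton does not change its language. -/
theorem exists_lang_eq_of_equiv {Q' : Type} (M : BA Q A) (e : Q' ≃ Q) :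
    ∃ B : BA Q' A, B.lang = M.lang := by
  refine ⟨⟨{t | (e t.1, t.2.1, e t.2.2) ∈ M.delta}, {q | e q ∈ M.init},
    {t | (e t.1, t.2.1, e t.2.2) ∈ M.F}, fun _ ht => M.F_sub ht⟩, Set.ext fun w => ⟨?_, ?_⟩⟩
  · rintro ⟨ρ, h⟩
    exact ⟨fun i => e (ρ i), h⟩
  · rintro ⟨ρ, h⟩
    refine ⟨fun i => e.symm (ρ i), ?_⟩
    simpa [AccRun, IsRun] using h

end

end BA

theorem statement6 {Q A : Type} [Fintype Q] [Fintype A] [Nonempty A]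
    (M : BA Q A) (hcompl : M.Complete)
    (helev : ∀ C, M.IsAccSCC C → M.InherentlyWeak C ∨ M.DetSCC C)
    (hF : ∀ p a q, (p, a, q) ∈ M.F → ∃ C, M.IsSCC C ∧ p ∈ C ∧ q ∈ C) :
    ∃ (m : ℕ) (B : BA (Fin m) A),
      m ≤ 2 * 2 ^ ((M.weakPart ∪ M.detPart)ᶜ.ncard) * 3 ^ (M.weakPart.ncard) *
            4 ^ (M.detPart.ncard) ∧
      m ≤ 2 * 4 ^ (Fintype.card Q) ∧
      B.lang = (M.lang)ᶜ := by
  obtain ⟨B, hB⟩ := BA.exists_lang_eq_of_equiv M.complement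
    (Fintype.equivFin (∀ q, Fin (M.numLabels q))).symm
  have hcard : Fintype.card (∀ q, Fin (M.numLabels q)) = ∏ q, M.numLabels q := by simp
  refine ⟨_, B, ?_, ?_, ?_⟩
  · rw [hcard]
    have := M.prod_numLabels_le
    nlinarith
  · rw [hcard]
    have := M.prod_numLabels_le_four_pow
    omega
  · rw [hB]
    exact (BA.complement_lang_subset helev).antisymm (BA.subset_complement_lang hcompl)
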